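/- arXiv:1602.04985 — 5 statements merged into one kernel-verified Lean document; each statement's English description precedes it below -/
import Mathlib

section
/- Let G be a finite simple graph on n vertices whose average degree D = 2·e(G)/n satisfies D < n − 1. Then there exist two distinct nonadjacent vertices x and y of G such that d(x) + d(y) ≥ D. -/
/-- Lemma 2.6: if the average degree `D = 2·e(G)/n` of a finite simple graph `G` on `n`
vertices satisfies `D < n - 1`, then there are two distinct nonadjacent vertices `x, y`
with `d(x) + d(y) ≥ D`. -/
theorem avg_degree_nonadjacent_pair {V : Type*} [Fintype V] [DecidableEq V]
    (G : SimpleGraph V) [DecidableRel G.Adj] (D : ℝ)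
    (hD : D = 2 * (G.edgeFinset.card : ℝ) / (Fintype.card V : ℝ))
    (hlt : D < (Fintype.card V : ℝ) - 1) :
    ∃ x y : V, x ≠ y ∧ ¬ G.Adj x y ∧ D ≤ (G.degree x : ℝ) + (G.degree y : ℝ) := by
  have hD_nonneg : 0 ≤ D := by rw [hD]; positivity
  have hn : (0 : ℝ) < Fintype.card V := by linarith
  have hsum : ∑ v, G.degree v = 2 * G.edgeFinset.card := G.sum_degrees_eq_twice_card_edges
  let U : Finset V := Finset.univ.filter fun v => ∀ w, v ≠ w → G.Adj v w
  have hU : Uᶜ.Nonempty := by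
    by_contra hne
    have huniv : ∀ v w, v ≠ w → G.Adj v w := by
      simpa [U, Finset.not_nonempty_iff_eq_empty, Finset.eq_univ_iff_forall] using hne
    have hdeg : ∀ v, (G.degree v : ℝ) = Fintype.card V - 1 := by
      intro v
      have hv : G.neighborFinset v = {v}ᶜ := by
        ext w
        simpa [eq_comm] using ⟨fun h => h.ne, huniv v w⟩
      rw [← G.card_neighborFinset_eq_degree, hv, Finset.card_compl, Finset.card_singleton,
        Nat.cast_sub (by exact_mod_cast hn), Nat.cast_one]
    have hsum' : ∑ v, (G.degree v : ℝ) = 2 * G.edgeFinset.card := by exact_mod_cast hsum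
    simp only [hdeg, Finset.sum_const, Finset.card_univ, nsmul_eq_mul] at hsum'
    rw [hD, ← hsum', mul_div_cancel_left₀ _ hn.ne'] at hlt
    exact lt_irrefl _ hlt
  obtain ⟨x, hx, hmax⟩ := Uᶜ.exists_max_image (fun v => G.degree v) hU
  obtain ⟨y, hxy, hadj⟩ : ∃ y, x ≠ y ∧ ¬ G.Adj x y := by
    simpa [U] using hx
  have hUy : U.card ≤ G.degree y := by
    rw [← G.card_neighborFinset_eq_degree]
    refine Finset.card_le_card fun v hv => ?_
    have hv' : ∀ w, v ≠ w → G.Adj v w := by simpa [U] using hv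
    have hvy : v ≠ y := by
      rintro rfl
      exact hadj (hv' x hxy.symm).symm
    simpa using (hv' y hvy).symm
  have hbound : 2 * G.edgeFinset.card ≤ (G.degree x + G.degree y) * Fintype.card V := by
    calc 2 * G.edgeFinset.card = ∑ v, G.degree v := hsum.symm
      _ ≤ ∑ v, (G.degree x + if v ∈ U then Fintype.card V else 0) := by
        refine Finset.sum_le_sum fun v _ => ?_
        split_ifs with hv
        · exact (G.degree_lt_card_verts v).le.trans (Nat.le_add_left _ _)
        · exact hmax v (Finset.mem_compl.mpr hv)
      _ = (G.degree x + U.card) * Fintype.card V := by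
        simp [Finset.sum_add_distrib]
        ring
      _ ≤ _ := by gcongr
  refine ⟨x, y, hxy, hadj, ?_⟩
  rw [hD, div_le_iff₀ hn]
  exact_mod_cast hbound
end

section
/- Let G be a finite simple graph with n ≥ 2 vertices and m edges. Then the sum over all vertices p of d(p)² is at most m·(2m/(n − 1) + n − 2). -/
open Finset in
/-- Bounds on the sum of the degrees of the neighbours of `v`, in terms of the number `e` of edges
from neighbours of `v` to vertices outside the closed neighbourhood of `v`. -/
lemma SimpleGraph.exists_sum_neighbor_degree_le {V : Type*} [Fintype V] [DecidableEq V]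
    (G : SimpleGraph V) [DecidableRel G.Adj] (v : V) :
    ∃ e : ℕ, ∑ u ∈ G.neighborFinset v, G.degree u ≤ G.degree v ^ 2 + e ∧
      e + G.degree v + ∑ u ∈ G.neighborFinset v, G.degree u ≤ ∑ u, G.degree u ∧
      e + G.degree v * (G.degree v + 1) ≤ G.degree v * Fintype.card V := by
  set N := G.neighborFinset v with hN
  have hv : v ∉ N := by simp [hN]
  have hcN : #N = G.degree v := G.card_neighborFinset_eq_degree v
  set W := (insert v N)ᶜ with hW
  have hcW : #W + (G.degree v + 1) = Fintype.card V := by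
    rw [← hcN, ← card_insert_of_notMem hv, hW, add_comm, card_add_card_compl]
  refine ⟨∑ u ∈ N, #{w ∈ W | G.Adj u w}, ?_, ?_, ?_⟩
  · have hdeg (u) (hu : u ∈ N) : G.degree u ≤ G.degree v + #{w ∈ W | G.Adj u w} := by
      have hsub : G.neighborFinset u ⊆ (insert v N).erase u ∪ {w ∈ W | G.Adj u w} := by
        intro w hw
        have hadj : G.Adj u w := by simpa using hw
        have hne : w ≠ u := hadj.ne'
        by_cases h : w ∈ insert v N
        · exact mem_union_left _ (mem_erase.2 ⟨hne, h⟩)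
        · exact mem_union_right _ (mem_filter.2 ⟨mem_compl.2 h, hadj⟩)
      have hcard := (card_le_card hsub).trans (card_union_le _ _)
      rwa [card_erase_of_mem (mem_insert_of_mem hu), card_insert_of_notMem hv, hcN,
        G.card_neighborFinset_eq_degree, Nat.add_sub_cancel] at hcard
    calc ∑ u ∈ N, G.degree u ≤ ∑ u ∈ N, (G.degree v + #{w ∈ W | G.Adj u w}) := sum_le_sum hdeg
      _ = _ := by rw [sum_add_distrib, sum_const, hcN, smul_eq_mul, sq]
  · have hle : ∑ u ∈ N, #{w ∈ W | G.Adj u w} ≤ ∑ w ∈ W, G.degree w := by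
      rw [show ∑ u ∈ N, #{w ∈ W | G.Adj u w} = ∑ w ∈ W, #{u ∈ N | G.Adj u w} from
        sum_card_bipartiteAbove_eq_sum_card_bipartiteBelow G.Adj]
      refine sum_le_sum fun w _ ↦ ?_
      rw [← G.card_neighborFinset_eq_degree]
      exact card_le_card fun u hu ↦ by simpa using (mem_filter.1 hu).2.symm
    rw [← sum_add_sum_compl (insert v N), sum_insert hv]
    linarith
  · have hle : ∑ u ∈ N, #{w ∈ W | G.Adj u w} ≤ #N * #W :=
      sum_le_card_nsmul _ _ _ fun _ _ ↦ card_filter_le _ _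
    rw [← hcW, ← hcN]
    rw [hcN] at hle ⊢
    linarith [mul_add (#N) (#W) (#N + 1)]

/-- The bound `d(v) + m(v) ≤ 2m/(n-1) + n - 2`, where `m(v)` is the average degree of the
neighbours of `v`, with denominators cleared. -/
lemma SimpleGraph.degree_sq_add_sum_neighbor_degree_le {V : Type*} [Fintype V] [DecidableEq V]
    (G : SimpleGraph V) [DecidableRel G.Adj] (v : V) :
    ((G.degree v : ℝ) ^ 2 + ∑ u ∈ G.neighborFinset v, (G.degree u : ℝ)) *
        ((Fintype.card V : ℝ) - 1) ≤
      G.degree v * (2 * (G.edgeFinset.card : ℝ) +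
        ((Fintype.card V : ℝ) - 1) * ((Fintype.card V : ℝ) - 2)) := by
  obtain ⟨e, h₁, h₂, h₃⟩ := G.exists_sum_neighbor_degree_le v
  rw [G.sum_degrees_eq_twice_card_edges] at h₂
  rw [← Nat.cast_sum]
  set T := ∑ u ∈ G.neighborFinset v, G.degree u
  obtain ⟨k, hk⟩ : ∃ k, Fintype.card V = G.degree v + 1 + k :=
    Nat.exists_eq_add_of_le (G.degree_lt_card_verts v)
  set d := G.degree v
  rw [hk] at h₃ ⊢
  have h₁' : (T : ℝ) ≤ d ^ 2 + e := by exact_mod_cast h₁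
  have h₂' : (e : ℝ) + d + T ≤ 2 * G.edgeFinset.card := by exact_mod_cast h₂
  have h₃' : (e : ℝ) ≤ d * k := by
    have : e ≤ d * k := by linarith [mul_add d (d + 1) k]
    exact_mod_cast this
  have hd : (0 : ℝ) ≤ d := d.cast_nonneg
  have hk₀ : (0 : ℝ) ≤ k := k.cast_nonneg
  have he : (0 : ℝ) ≤ e := e.cast_nonneg
  have key : (e : ℝ) * k ≤ d * e + d * k * (k - 1) := by
    rcases Nat.eq_zero_or_pos k with h | h
    · simp only [h, Nat.cast_zero]
      nlinarith [mul_nonneg hd he]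
    rcases Nat.eq_zero_or_pos d with h' | h'
    · simp only [h', Nat.cast_zero] at h₃' ⊢
      nlinarith
    have hk₁ : (1 : ℝ) ≤ k := by exact_mod_cast h
    have hd₁ : (1 : ℝ) ≤ d := by exact_mod_cast h'
    rcases le_total (k : ℝ) d with hkd | hkd
    · nlinarith [mul_nonneg he (sub_nonneg.2 hkd),
        mul_nonneg (mul_nonneg hd hk₀) (sub_nonneg.2 hk₁)]
    · nlinarith [mul_nonneg (sub_nonneg.2 h₃') (sub_nonneg.2 hkd),
        mul_nonneg (mul_nonneg hd hk₀) (sub_nonneg.2 hd₁)]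
  push_cast
  nlinarith [mul_le_mul_of_nonneg_left h₂' hd, mul_le_mul_of_nonneg_right h₁' hk₀]

lemma SimpleGraph.sum_sum_neighbor_degree {V : Type*} [Fintype V] [DecidableEq V]
    (G : SimpleGraph V) [DecidableRel G.Adj] :
    ∑ v, ∑ u ∈ G.neighborFinset v, (G.degree u : ℝ) = ∑ v, (G.degree v : ℝ) ^ 2 := by
  rw [Finset.sum_comm' (t' := Finset.univ) (s' := fun u ↦ G.neighborFinset u)
    (by simp [G.adj_comm])]
  simp [sq]


/-- de Caen's bound: for a finite simple graph with `n ≥ 2` vertices and `m` edges,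
`∑_p d(p)² ≤ m·(2m/(n-1) + n - 2)`. -/
theorem deCaen_sum_sq_degrees {V : Type*} [Fintype V] [DecidableEq V]
    (G : SimpleGraph V) [DecidableRel G.Adj]
    (hn : 2 ≤ Fintype.card V) :
    ∑ p : V, ((G.degree p : ℝ)) ^ 2
      ≤ (G.edgeFinset.card : ℝ) *
          (2 * (G.edgeFinset.card : ℝ) / ((Fintype.card V : ℝ) - 1)
            + (Fintype.card V : ℝ) - 2) := by
  have hn' : (0 : ℝ) < (Fintype.card V : ℝ) - 1 := by
    have : (2 : ℝ) ≤ Fintype.card V := by exact_mod_cast hn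
    linarith
  have hsum := Finset.sum_le_sum fun v (_ : v ∈ Finset.univ) ↦
    G.degree_sq_add_sum_neighbor_degree_le v
  rw [← Finset.sum_mul, ← Finset.sum_mul, Finset.sum_add_distrib, G.sum_sum_neighbor_degree,
    ← Nat.cast_sum, G.sum_degrees_eq_twice_card_edges] at hsum
  push_cast at hsum
  refine le_of_mul_le_mul_right ?_ hn'
  have hdiv : 2 * (G.edgeFinset.card : ℝ) / ((Fintype.card V : ℝ) - 1) *
      ((Fintype.card V : ℝ) - 1) = 2 * G.edgeFinset.card := div_mul_cancel₀ _ hn'.ne'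
  linear_combination hsum / 2 - (G.edgeFinset.card : ℝ) * hdiv
end

section
/- Let G be a finite simple graph with n vertices and maximum degree at most Δ. Then G admits a proper vertex coloring with Δ + 1 colors in which every color class has size either ⌊n/(Δ+1)⌋ or ⌈n/(Δ+1)⌉. -/
namespace HajnalSzemeredi

open Finset Function
open scoped Classical

variable {V ι : Type*}

/-! ### Reachability in a digraph -/

/-- `Reaches R Q a c`: there is an `R`-walk from `c` to `a` all of whose vertices lie in `Q`. -/
inductive Reaches (R : ι → ι → Prop) (Q : Set ι) (a : ι) : ι → Prop
  | base : a ∈ Q → Reaches R Q a a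
  | step {c d : ι} : c ∈ Q → R c d → Reaches R Q a d → Reaches R Q a c

/-- `SimplePath R a c P`: there is an `R`-path without repetitions from `c` to `a` with
vertex set `P`. -/
inductive SimplePath (R : ι → ι → Prop) (a : ι) : ι → Set ι → Prop
  | base : SimplePath R a a {a}
  | step {c d : ι} {P : Set ι} :
      R c d → SimplePath R a d P → c ∉ P → SimplePath R a c (insert c P)

lemma Reaches.mem {R : ι → ι → Prop} {Q : Set ι} {a c : ι} (h : Reaches R Q a c) : c ∈ Q := by
  cases h <;> assumption

lemma Reaches.mono {R : ι → ι → Prop} {Q Q' : Set ι} {a c : ι} (h : Reaches R Q a c)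
    (hQ : ∀ e, Reaches R Q a e → e ∈ Q') : Reaches R Q' a c := by
  induction h with
  | base h => exact .base (hQ _ (.base h))
  | step h₁ h₂ h₃ ih => exact .step (hQ _ (.step h₁ h₂ h₃)) h₂ ih

lemma SimplePath.start_mem {R : ι → ι → Prop} {a c : ι} {P : Set ι} (h : SimplePath R a c P) :
    c ∈ P := by
  cases h <;> simp

lemma SimplePath.exists_of_mem {R : ι → ι → Prop} {a c e : ι} {P : Set ι}
    (h : SimplePath R a c P) (he : e ∈ P) : ∃ P' ⊆ P, SimplePath R a e P' := by
  induction h with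
  | base =>
    obtain rfl : e = a := he
    exact ⟨_, subset_rfl, .base⟩
  | @step c d P h₁ h₂ h₃ ih =>
    rcases he with rfl | he
    · exact ⟨_, subset_rfl, .step h₁ h₂ h₃⟩
    · obtain ⟨P', hP', h⟩ := ih he
      exact ⟨P', hP'.trans (Set.subset_insert _ _), h⟩

lemma Reaches.exists_simplePath {R : ι → ι → Prop} {Q : Set ι} {a c : ι} (h : Reaches R Q a c) :
    ∃ P : Set ι, SimplePath R a c P ∧ ∀ e ∈ P, Reaches R Q a e := by
  induction h with
  | base h => exact ⟨{a}, .base, by rintro e rfl; exact .base h⟩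
  | @step c d h₁ h₂ h₃ ih =>
    obtain ⟨P, hP, hr⟩ := ih
    by_cases hc : c ∈ P
    · obtain ⟨P', hP', h⟩ := hP.exists_of_mem hc
      exact ⟨P', h, fun e he => hr e (hP' he)⟩
    · refine ⟨insert c P, .step h₂ hP hc, ?_⟩
      rintro e (rfl | he)
      · exact .step h₁ h₂ h₃
      · exact hr e he

/-- If some vertex other than `a` reaches `a`, then there are a vertex `U` and a nonempty set `T`
of vertices reaching `a` such that deleting a vertex of `T` keeps all the others able to reach `a`,
and such that arcs leaving `T` within the set of vertices reaching `a` end in `U`. -/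
lemma exists_terminal_set (R : ι → ι → Prop) (K : Finset ι) {a c₀ : ι}
    (hc₀ : Reaches R K a c₀) (hne : c₀ ≠ a) :
    ∃ (U : ι) (T : Finset ι), T.Nonempty ∧ Reaches R K a U ∧ U ∉ T ∧ a ∉ T ∧
      (∀ c ∈ T, Reaches R K a c) ∧
      (∀ W ∈ T, ∀ c, Reaches R K a c → c ≠ W → Reaches R (K \ {W} : Set ι) a c) ∧
      (∀ c ∈ T, ∀ d, Reaches R K a d → d ∉ T → d ≠ U → ¬ R c d) := by
  have haa : Reaches R K a a := by
    clear hne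
    induction hc₀ with
    | base h => exact .base h
    | step _ _ _ ih => exact ih
  let T : ι → Finset ι := fun U =>
    K.filter fun c => Reaches R K a c ∧ c ≠ U ∧ ¬ Reaches R (K \ {U} : Set ι) a c
  have hT : ∀ U c, c ∈ T U ↔
      Reaches R K a c ∧ c ≠ U ∧ ¬ Reaches R (K \ {U} : Set ι) a c := fun U c => by
    simp only [T, mem_filter, and_iff_right_iff_imp]
    exact fun h => by simpa using h.1.mem
  have hnot : ∀ c, ¬ Reaches R (K \ {a} : Set ι) a c := fun c h => by
    induction h with
    | base h => exact h.2 rfl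
    | step _ _ _ ih => exact ih
  obtain ⟨U, hU, hmin⟩ := exists_min_image
    (K.filter fun U => Reaches R K a U ∧ (T U).Nonempty) (fun U => (T U).card)
    ⟨a, mem_filter.2 ⟨by simpa using haa.mem, haa, c₀, (hT _ _).2 ⟨hc₀, hne, hnot _⟩⟩⟩
  simp only [mem_filter] at hU hmin
  refine ⟨U, T U, hU.2.2, hU.2.1, fun h => ((hT _ _).1 h).2.1 rfl, fun h => ?_,
    fun c hc => ((hT _ _).1 hc).1, fun W hW c hc hcW => ?_, fun c hc d hd hdT hdU hR => ?_⟩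
  · obtain ⟨-, h₁, h₂⟩ := (hT _ _).1 h
    exact h₂ (.base ⟨haa.mem, h₁⟩)
  · obtain ⟨hW₁, hW₂, hW₃⟩ := (hT _ _).1 hW
    by_contra hcon
    have key : ∀ e, Reaches R (K \ {U} : Set ι) a e → Reaches R (K \ {W} : Set ι) a e :=
      fun e he => he.mono fun e' he' => ⟨he'.mem.1, by rintro rfl; exact hW₃ he'⟩
    have keyU : Reaches R (K \ {W} : Set ι) a U := by
      have : ∀ e, Reaches R K a e →
          Reaches R (K \ {U} : Set ι) a e ∨ Reaches R (K \ {W} : Set ι) a U := by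
        intro e he
        induction he with
        | base h =>
          by_cases haU : a = U
          · subst haU
            exact .inr (.base ⟨h, hW₂.symm⟩)
          · exact .inl (.base ⟨h, haU⟩)
        | @step e d h₁ h₂ h₃ ih =>
          rcases ih with ih | ih
          · by_cases heU : e = U
            · subst heU
              exact .inr (.step ⟨h₁, hW₂.symm⟩ h₂ (key _ ih))
            · exact .inl (.step ⟨h₁, heU⟩ h₂ ih)
          · exact .inr ih
      rcases this U hU.2.1 with h | h
      · exact absurd rfl h.mem.2
      · exact h
    have hWK : W ∈ K := by simpa using hW₁.mem
    have hlt : (T W).card < (T U).card := by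
      refine card_lt_card ⟨fun e he => ?_, fun h => ((hT _ _).1 (h hW)).2.1 rfl⟩
      obtain ⟨h₁, h₂, h₃⟩ := (hT _ _).1 he
      refine (hT _ _).2 ⟨h₁, ?_, fun h => h₃ (key _ h)⟩
      rintro rfl
      exact h₃ keyU
    exact absurd (hmin W ⟨hWK, hW₁, c, (hT _ _).2 ⟨hc, hcW, hcon⟩⟩) (by omega)
  · obtain ⟨h₁, h₂, h₃⟩ := (hT _ _).1 hc
    have : Reaches R (K \ {U} : Set ι) a d := by
      by_contra h
      exact hdT ((hT _ _).2 ⟨hd, hdU, h⟩)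
    exact h₃ (.step ⟨h₁.mem, h₂⟩ hR this)

/-! ### Partial colorings and moves -/

/-- `f` is a proper coloring of `G[S]` with colors in `K`. -/
structure ProperOn (G : SimpleGraph V) (S : Finset V) (K : Finset ι) (f : V → ι) : Prop where
  mem : ∀ v ∈ S, f v ∈ K
  ne : ∀ u ∈ S, ∀ v ∈ S, G.Adj u v → f u ≠ f v

/-- The number of vertices of `S` colored `c` by `f`. -/
noncomputable def classSize (S : Finset V) (f : V → ι) (c : ι) : ℕ :=
  (S.filter fun v => f v = c).card

/-- The vertex `v` has no neighbors in the color class `c`. -/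
def Movable (G : SimpleGraph V) (S : Finset V) (f : V → ι) (v : V) (c : ι) : Prop :=
  ∀ w ∈ S, f w = c → ¬ G.Adj v w

/-- Some vertex of the color class `c` can be moved to the color class `d ≠ c`. -/
def MoveRel (G : SimpleGraph V) (S : Finset V) (f : V → ι) (c d : ι) : Prop :=
  c ≠ d ∧ ∃ y ∈ S, f y = c ∧ Movable G S f y d

/-- `G[S]` has a proper coloring with color set `K` in which all classes have size `s`. -/
def HasEquitable (G : SimpleGraph V) (S : Finset V) (K : Finset ι) (s : ℕ) : Prop :=
  ∃ f : V → ι, ProperOn G S K f ∧ ∀ c ∈ K, classSize S f c = s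

/-- The edge `yz` is the only edge from `y` to the color class of `z`. -/
def Solo (G : SimpleGraph V) (S : Finset V) (f : V → ι) (z y : V) : Prop :=
  z ∈ S ∧ G.Adj y z ∧ ∀ w ∈ S, f w = f z → G.Adj y w → w = z

variable {G : SimpleGraph V} {S : Finset V} {K : Finset ι} {f : V → ι}

lemma classSize_update {y : V} (hy : y ∈ S) (d e : ι) :
    classSize S (update f y d) e + (if e = f y then 1 else 0) =
      classSize S f e + (if e = d then 1 else 0) := by
  have h : ∀ g : V → ι, classSize S g e =
      classSize (S.erase y) g e + (if e = g y then 1 else 0) := by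
    intro g
    unfold classSize
    conv_lhs => rw [← insert_erase hy, filter_insert]
    split_ifs <;> simp_all
  have h' : classSize (S.erase y) (update f y d) e = classSize (S.erase y) f e := by
    unfold classSize
    congr 1
    exact filter_congr fun v hv => by rw [update_of_ne (ne_of_mem_erase hv)]
  rw [h, h f, h', update_self]
  omega

lemma properOn_update {y : V} {d : ι} (hK : ∀ v ∈ S, f v ∈ K)
    (hf : ∀ u ∈ S, ∀ v ∈ S, u ≠ y → v ≠ y → G.Adj u v → f u ≠ f v) (hd : d ∈ K)
    (hm : Movable G S f y d) : ProperOn G S K (update f y d) := by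
  refine ⟨fun v hv => ?_, fun u hu v hv huv => ?_⟩
  · by_cases h : v = y
    · subst h; simpa
    · rw [update_of_ne h]; exact hK v hv
  · have := huv.ne
    by_cases h : u = y
    · subst h
      rw [update_self, update_of_ne this.symm]
      exact fun h' => hm v hv h'.symm huv
    · by_cases h' : v = y
      · subst h'
        rw [update_self, update_of_ne this]
        exact fun h'' => hm u hu h'' huv.symm
      · rw [update_of_ne h, update_of_ne h']
        exact hf u hu v hv h h' huv

lemma properOn_insert_update {T : Finset V} {z : V} {Y : ι} (hf : ProperOn G T K f) (hz : z ∉ T)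
    (hY : Y ∈ K) (hm : Movable G T f z Y) :
    ProperOn G (insert z T) K (update f z Y) ∧
      ∀ c, classSize (insert z T) (update f z Y) c =
        classSize T f c + (if c = Y then 1 else 0) := by
  have hne : ∀ v ∈ T, v ≠ z := fun v hv h => hz (h ▸ hv)
  refine ⟨⟨fun v hv => ?_, fun u hu v hv huv => ?_⟩, fun c => ?_⟩
  · rcases mem_insert.1 hv with rfl | hv
    · simpa
    · rw [update_of_ne (hne v hv)]; exact hf.mem v hv
  · have := huv.ne
    rcases mem_insert.1 hu with rfl | hu' <;> rcases mem_insert.1 hv with rfl | hv'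
    · exact absurd rfl this
    · rw [update_self, update_of_ne this.symm]
      exact fun h' => hm v hv' h'.symm huv
    · rw [update_self, update_of_ne this]
      exact fun h' => hm u hu' h' huv.symm
    · rw [update_of_ne (hne u hu'), update_of_ne (hne v hv')]
      exact hf.ne u hu' v hv' huv
  · unfold classSize
    have : T.filter (fun v => update f z Y v = c) = T.filter fun v => f v = c :=
      filter_congr fun v hv => by rw [update_of_ne (hne v hv)]
    rw [filter_insert, update_self, this]
    by_cases h : c = Y
    · rw [if_pos h.symm, if_pos h, card_insert_of_notMem fun h' => hz (mem_filter.1 h').1]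
    · rw [if_neg (Ne.symm h), if_neg h, add_zero]

/-- Shifting one vertex along each arc of a path from `c` to `a`. -/
lemma exists_shift {a c : ι} {P : Set ι} (hf : ProperOn G S K f) (hPK : P ⊆ K)
    (hP : SimplePath (MoveRel G S f) a c P) :
    ∃ f' : V → ι, ProperOn G S K f' ∧ (∀ v, f v ∉ P → f' v = f v) ∧ (∀ v, f v ∈ P → f' v ∈ P) ∧
      (∀ v, f' v = c → f v = c) ∧
      ∀ e, classSize S f' e + (if e = c then 1 else 0) =
        classSize S f e + (if e = a then 1 else 0) := by
  induction hP with
  | base => exact ⟨f, hf, fun _ _ => rfl, fun _ h => h, fun _ h => h, fun _ => rfl⟩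
  | @step c d P hR hd hc ih =>
    obtain ⟨f', h₁, h₂, h₃, h₄, h₅⟩ := ih fun e he => hPK (Set.mem_insert_of_mem _ he)
    obtain ⟨-, y, hyS, rfl, hy⟩ := hR
    have hdP := hd.start_mem
    have hyf : f' y = f y := h₂ y hc
    refine ⟨update f' y d, properOn_update h₁.mem (fun u hu v hv _ _ => h₁.ne u hu v hv)
      (hPK (Set.mem_insert_of_mem _ hdP)) fun w hw hwd => hy w hw (h₄ w hwd), fun v hv => ?_,
      fun v hv => ?_, fun v hv => ?_, fun e => ?_⟩
    · rw [Set.mem_insert_iff, not_or] at hv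
      rw [update_of_ne (by rintro rfl; exact hv.1 rfl), h₂ v hv.2]
    · by_cases hvy : v = y
      · subst hvy
        rw [update_self]
        exact Set.mem_insert_of_mem _ hdP
      · rw [update_of_ne hvy]
        by_cases hvP : f v ∈ P
        · exact Set.mem_insert_of_mem _ (h₃ v hvP)
        · rwa [h₂ v hvP]
    · by_cases hvy : v = y
      · rw [hvy]
      · rw [update_of_ne hvy] at hv
        by_cases hvP : f v ∈ P
        · exact absurd (hv ▸ h₃ v hvP) hc
        · rwa [h₂ v hvP] at hv
    · have := classSize_update (f := f') hyS d e
      have := h₅ e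
      rw [hyf] at *
      omega

/-- Recoloring the vertices whose color is not in `A`. -/
lemma properOn_glue {A : Finset ι} {f g : V → ι} (hA : A ⊆ K)
    (hf : ∀ u ∈ S, ∀ v ∈ S, G.Adj u v → f u ∈ A → f u ≠ f v)
    (hg : ProperOn G (S.filter fun v => f v ∉ A) (K \ A) g) :
    ProperOn G S K (fun v => if f v ∈ A then f v else g v) ∧
      (∀ c ∈ A, classSize S (fun v => if f v ∈ A then f v else g v) c = classSize S f c) ∧
      ∀ c ∈ K \ A, classSize S (fun v => if f v ∈ A then f v else g v) c =
        classSize (S.filter fun v => f v ∉ A) g c := by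
  have hgm : ∀ v ∈ S, f v ∉ A → g v ∈ K ∧ g v ∉ A := fun v hv hvA => by
    simpa using hg.mem v (mem_filter.2 ⟨hv, hvA⟩)
  refine ⟨⟨fun v hv => ?_, fun u hu v hv huv => ?_⟩, fun c hc => ?_, fun c hc => ?_⟩
  · split_ifs with h
    · exact hA h
    · exact (hgm v hv h).1
  · have h₁ := hf u hu v hv huv
    split_ifs with h h' h'
    · exact h₁ h
    · exact fun h'' => (hgm v hv h').2 (h'' ▸ h)
    · exact fun h'' => (hgm u hu h).2 (h'' ▸ h')
    · exact hg.ne u (mem_filter.2 ⟨hu, h⟩) v (mem_filter.2 ⟨hv, h'⟩) huv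
  · unfold classSize
    congr 1
    refine filter_congr fun v hv => ?_
    dsimp only
    split_ifs with h
    · rfl
    · exact ⟨fun h' => absurd (h' ▸ hc) (hgm v hv h).2, fun h' => absurd (h' ▸ hc) h⟩
  · unfold classSize
    rw [filter_filter]
    congr 1
    refine filter_congr fun v hv => ?_
    dsimp only
    split_ifs with h
    · simp only [h, not_true_eq_false, false_and, iff_false]
      rintro rfl
      exact (mem_sdiff.1 hc).2 h
    · simp [h]

/-! ### Degree counting -/

/-- A vertex has at least as many neighbors as there are color classes it cannot be moved to. -/
lemma card_add_card_le_degree {C : Finset ι} {X : Finset V} {v : V}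
    (hC : ∀ c ∈ C, ¬ Movable G S f v c) (hX : X ⊆ S.filter (G.Adj v))
    (hXC : ∀ w ∈ X, f w ∉ C) : C.card + X.card ≤ (S.filter (G.Adj v)).card := by
  have h₁ : C.card ≤ ((S.filter (G.Adj v)).filter fun w => f w ∈ C).card := by
    refine card_le_card_of_surjOn f fun c hc => ?_
    have := hC c hc
    simp only [Movable, not_forall, not_not] at this
    obtain ⟨w, hw, rfl, hvw⟩ := this
    exact ⟨w, by simpa [hw, hvw] using hc, rfl⟩
  have h₂ : X.card ≤ ((S.filter (G.Adj v)).filter fun w => ¬ f w ∈ C).card :=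
    card_le_card fun w hw => mem_filter.2 ⟨hX hw, hXC w hw⟩
  have := card_filter_add_card_filter_not (s := S.filter (G.Adj v)) (fun w => f w ∈ C)
  omega

lemma exists_movable_color {v : V} (h : (S.filter (G.Adj v)).card < K.card) :
    ∃ c ∈ K, Movable G S f v c := by
  by_contra! hcon
  have := card_add_card_le_degree (X := ∅) hcon (by simp) (by simp)
  simp at this
  omega


/-- Vertices outside the classes in `A` have many solo edges if their degree is small. -/
lemma card_add_le_card_solo {A T : Finset ι} {y : V} {q : ℕ} (hTA : T ⊆ A)
    (hdeg : (S.filter (G.Adj y)).card < A.card + q) (hA : ∀ c ∈ A, ¬ Movable G S f y c) :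
    T.card + 1 + (S.filter fun w => f w ∉ A ∧ G.Adj y w).card ≤
      (S.filter fun z => f z ∈ T ∧ Solo G S f z y).card + q := by
  set N := (S.filter (G.Adj y)).filter fun w => f w ∈ A with hN
  set Z := S.filter fun z => f z ∈ T ∧ Solo G S f z y with hZ
  have h₁ : N.card = ∑ c ∈ A, (N.filter fun w => f w = c).card :=
    card_eq_sum_card_fiberwise fun w hw => (mem_filter.1 hw).2
  have h₂ : Z.card = ∑ c ∈ A, (Z.filter fun w => f w = c).card :=
    card_eq_sum_card_fiberwise fun w hw => hTA (mem_filter.1 hw).2.1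
  have h₃ : ∑ c ∈ A, (1 + if c ∈ T then 1 else 0) ≤
      ∑ c ∈ A, ((N.filter fun w => f w = c).card + (Z.filter fun w => f w = c).card) := by
    refine sum_le_sum fun c hc => ?_
    have := hA c hc
    simp only [Movable, not_forall, not_not] at this
    obtain ⟨z, hz, rfl, hyz⟩ := this
    have hzN : z ∈ N.filter fun w => f w = f z := by simp [hN, hz, hyz, hc]
    have hpos : 0 < (N.filter fun w => f w = f z).card := card_pos.2 ⟨z, hzN⟩
    split_ifs with hT
    · by_cases hsolo : Solo G S f z y
      · have : 0 < (Z.filter fun w => f w = f z).card :=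
          card_pos.2 ⟨z, by simp [hZ, hz, hT, hsolo]⟩
        omega
      · simp only [Solo, hz, hyz, true_and, not_forall] at hsolo
        obtain ⟨w, hw, hwz, hyw, hne⟩ := hsolo
        have : 1 < (N.filter fun w => f w = f z).card :=
          one_lt_card.2 ⟨w, by simp [hN, hw, hyw, hwz, hc], z, hzN, hne⟩
        omega
    · omega
  rw [sum_add_distrib, sum_add_distrib, ← h₁, ← h₂, ← card_filter, filter_mem_eq_inter,
    inter_eq_right.2 hTA, sum_const, smul_eq_mul, mul_one] at h₃
  have h₄ := card_filter_add_card_filter_not (s := S.filter (G.Adj y)) (fun w => f w ∈ A)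
  have h₅ : ((S.filter (G.Adj y)).filter fun w => ¬ f w ∈ A) =
      S.filter fun w => f w ∉ A ∧ G.Adj y w := by
    rw [filter_filter]
    exact filter_congr fun w _ => and_comm
  rw [h₅, ← hN] at h₄
  omega

/-- If no solo vertex of the class `W` can be moved within `A`, then `T` is large. -/
lemma lt_card_of_not_movable {A T : Finset ι} {U W : ι} {q s : ℕ}
    (hdeg : ∀ v ∈ S, (S.filter (G.Adj v)).card < A.card + q) (hTA : T ⊆ A) (hU : U ∈ A)
    (hUT : U ∉ T) (hW : W ∈ T) (hWs : classSize S f W = s)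
    (hB : (S.filter fun v => f v ∉ A).card = q * s + 1)
    (hA : ∀ y ∈ S, f y ∉ A → ∀ c ∈ A, ¬ Movable G S f y c)
    (hTm : ∀ x ∈ S, f x ∈ T → ∀ c ∈ A, c ∉ T → c ≠ U → ¬ Movable G S f x c)
    (hsolo : ∀ z y, f z = W → y ∈ S → f y ∉ A → Solo G S f z y →
      ∀ X ∈ A, X ≠ W → ¬ Movable G S f z X) :
    q < T.card := by
  set B := S.filter fun v => f v ∉ A with hBdef
  set C := S.filter fun v => f v = W with hC
  set Z := C.filter fun z => ∃ y ∈ B, Solo G S f z y with hZ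
  set D := C.filter fun z => ¬ ∃ y ∈ B, Solo G S f z y with hD
  have hZD : Z.card + D.card = s := by
    rw [← hWs]
    exact card_filter_add_card_filter_not _
  set N := B.filter fun y => ∃ z ∈ Z, G.Adj y z with hN
  set M := B.filter fun y => ¬ ∃ z ∈ Z, G.Adj y z with hM
  have hNM : N.card + M.card = q * s + 1 := by
    rw [← hB]
    exact card_filter_add_card_filter_not _
  have h₁ : N.card * 1 ≤ Z.card * q := by
    refine card_mul_le_card_mul G.Adj (fun y hy => ?_) fun z hz => ?_
    · obtain ⟨z, hz, hyz⟩ := (mem_filter.1 hy).2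
      exact card_pos.2 ⟨z, by simp [bipartiteAbove, hz, hyz]⟩
    · obtain ⟨hzC, y, hyB, hy⟩ := mem_filter.1 hz
      obtain ⟨hzS, hzW⟩ := mem_filter.1 hzC
      obtain ⟨hyS, hyA⟩ := mem_filter.1 hyB
      have := card_add_card_le_degree (C := A.erase W) (X := N.bipartiteBelow G.Adj z) (S := S)
        (fun c hc => hsolo z y hzW hyS hyA hy c (mem_of_mem_erase hc) (ne_of_mem_erase hc))
        (fun w hw => by
          simp only [bipartiteBelow, hN, hBdef, mem_filter] at hw
          exact mem_filter.2 ⟨hw.1.1.1, hw.2.symm⟩)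
        (fun w hw => by
          simp only [bipartiteBelow, hN, hBdef, mem_filter] at hw
          exact fun h => hw.1.1.2 (mem_of_mem_erase h))
      have h' := hdeg z hzS
      rw [card_erase_of_mem (hTA hW)] at this
      have := card_pos.2 ⟨W, hTA hW⟩
      omega
  have h₂ : M.card * 2 ≤ D.card * (T.card + q) := by
    refine card_mul_le_card_mul G.Adj (fun y hy => ?_) fun x hx => ?_
    · obtain ⟨hyB, hyZ⟩ := mem_filter.1 hy
      obtain ⟨hyS, hyA⟩ := mem_filter.1 hyB
      have hmem : ∀ w ∈ S, f w = W → G.Adj y w → w ∈ D.bipartiteAbove G.Adj y := by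
        intro w hw hwW hyw
        have hwC : w ∈ C := mem_filter.2 ⟨hw, hwW⟩
        refine mem_filter.2 ⟨mem_filter.2 ⟨hwC, fun h => hyZ ?_⟩, hyw⟩
        exact ⟨w, mem_filter.2 ⟨hwC, h⟩, hyw⟩
      have := hA y hyS hyA W (hTA hW)
      simp only [Movable, not_forall, not_not] at this
      obtain ⟨z, hz, hzW, hyz⟩ := this
      have hns : ¬ Solo G S f z y := fun h =>
        hyZ ⟨z, mem_filter.2 ⟨mem_filter.2 ⟨hz, hzW⟩, y, hyB, h⟩, hyz⟩
      simp only [Solo, hz, hyz, true_and, not_forall] at hns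
      obtain ⟨w, hw, hwz, hyw, hne⟩ := hns
      exact one_lt_card.2 ⟨w, hmem w hw (hwz.trans hzW) hyw, z, hmem z hz hzW hyz, hne⟩
    · obtain ⟨hxS, hxW⟩ := mem_filter.1 (mem_filter.1 hx).1
      have := card_add_card_le_degree (C := (A \ T).erase U) (X := M.bipartiteBelow G.Adj x)
        (S := S)
        (fun c hc => by
          simp only [mem_erase, mem_sdiff] at hc
          exact hTm x hxS (hxW ▸ hW) c hc.2.1 hc.2.2 hc.1)
        (fun w hw => by
          simp only [bipartiteBelow, hM, hBdef, mem_filter] at hw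
          exact mem_filter.2 ⟨hw.1.1.1, hw.2.symm⟩)
        (fun w hw => by
          simp only [bipartiteBelow, hM, hBdef, mem_filter] at hw
          exact fun h => hw.1.1.2 (mem_sdiff.1 (mem_of_mem_erase h)).1)
      have h' := hdeg x hxS
      have hUAT : U ∈ A \ T := mem_sdiff.2 ⟨hU, hUT⟩
      have h'' := card_sdiff_add_card_eq_card hTA
      rw [card_erase_of_mem hUAT] at this
      have := card_pos.2 ⟨U, hUAT⟩
      omega
  by_contra! hcon
  have h₃ : D.card * (T.card + q) ≤ D.card * (q + q) := Nat.mul_le_mul_left _ (by omega)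
  subst hZD
  nlinarith

/-- The key counting argument: some solo vertex can be moved within `A`, or has two nonadjacent
solo neighbors. -/
lemma exists_movable_or_nonadj {A T : Finset ι} {U : ι} {q s : ℕ}
    (hdeg : ∀ v ∈ S, (S.filter (G.Adj v)).card < A.card + q) (hTA : T ⊆ A) (hT : T.Nonempty)
    (hU : U ∈ A) (hUT : U ∉ T) (hTs : ∀ c ∈ T, classSize S f c = s)
    (hB : (S.filter fun v => f v ∉ A).card = q * s + 1)
    (hA : ∀ y ∈ S, f y ∉ A → ∀ c ∈ A, ¬ Movable G S f y c)
    (hTm : ∀ x ∈ S, f x ∈ T → ∀ c ∈ A, c ∉ T → c ≠ U → ¬ Movable G S f x c) :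
    ∃ z y, f z ∈ T ∧ y ∈ S ∧ f y ∉ A ∧ Solo G S f z y ∧
      ((∃ X ∈ A, X ≠ f z ∧ Movable G S f z X) ∨
        ∃ y' ∈ S, f y' ∉ A ∧ Solo G S f z y' ∧ y' ≠ y ∧ ¬ G.Adj y y') := by
  by_contra! hcon
  obtain ⟨W, hW⟩ := hT
  have hqT : q < T.card := by
    refine lt_card_of_not_movable hdeg hTA hU hUT hW (hTs W hW) hB hA hTm ?_
    rintro z y rfl hyS hyA hs X hX hXW
    exact (hcon z y hW hyS hyA hs).1 X hX hXW
  set B := S.filter fun v => f v ∉ A with hBdef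
  set Z := S.filter fun v => f v ∈ T with hZdef
  have hZ : Z.card = T.card * s := by
    rw [card_eq_sum_card_fiberwise (s := Z) (t := T) (f := f) fun w hw => (mem_filter.1 hw).2,
      ← smul_eq_mul, ← sum_const]
    refine sum_congr rfl fun c hc => ?_
    rw [← hTs c hc, classSize, hZdef, filter_filter]
    congr 1
    exact filter_congr fun v _ => ⟨fun h => h.2, fun h => ⟨h ▸ hc, h⟩⟩
  let N : V → Finset V := fun z => B.filter fun y => Solo G S f z y
  have hup : ∑ z ∈ Z, ∑ y ∈ B, (if Solo G S f z y then (q : ℚ) / (N z).card else 0) ≤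
      ∑ z ∈ Z, (q : ℚ) := by
    refine sum_le_sum fun z _ => ?_
    rw [← sum_filter, sum_const, nsmul_eq_mul]
    change ((N z).card : ℚ) * _ ≤ _
    by_cases h0 : ((N z).card : ℚ) = 0
    · rw [h0]; simp
    · rw [mul_div_cancel₀ _ h0]
  have hlow : ∑ y ∈ B, (T.card : ℚ) ≤
      ∑ y ∈ B, ∑ z ∈ Z, (if Solo G S f z y then (q : ℚ) / (N z).card else 0) := by
    refine sum_le_sum fun y hy => ?_
    obtain ⟨hyS, hyA⟩ := mem_filter.1 hy
    have hsol := card_add_le_card_solo hTA (hdeg y hyS) (hA y hyS hyA)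
    have hdB := card_add_card_le_degree (C := A) (S := S)
      (X := S.filter fun w => f w ∉ A ∧ G.Adj y w) (hA y hyS hyA)
      (fun w hw => mem_filter.2 ⟨(mem_filter.1 hw).1, (mem_filter.1 hw).2.2⟩)
      (fun w hw => (mem_filter.1 hw).2.1)
    have hdy := hdeg y hyS
    set e := (S.filter fun w => f w ∉ A ∧ G.Adj y w).card with he
    rw [← sum_filter, hZdef, filter_filter]
    have hNz : ∀ z ∈ S.filter (fun z => f z ∈ T ∧ Solo G S f z y),
        (q : ℚ) / (e + 1 : ℕ) ≤ (q : ℚ) / (N z).card := by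
      intro z hz
      obtain ⟨hzS, hzT, hzy⟩ := mem_filter.1 hz
      have hyN : y ∈ N z := mem_filter.2 ⟨hy, hzy⟩
      have hle : (N z).card ≤ e + 1 := by
        rw [← card_erase_add_one hyN, he]
        refine Nat.succ_le_succ (card_le_card fun w hw => ?_)
        obtain ⟨hwy, hwN⟩ := mem_erase.1 hw
        obtain ⟨hwB, hws⟩ := mem_filter.1 hwN
        obtain ⟨hwS, hwA⟩ := mem_filter.1 hwB
        exact mem_filter.2 ⟨hwS, hwA, (hcon z y hzT hyS hyA hzy).2 w hwS hwA hws hwy⟩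
      have hpos : 0 < (N z).card := card_pos.2 ⟨y, hyN⟩
      gcongr
    refine le_trans ?_ (sum_le_sum hNz)
    rw [sum_const, nsmul_eq_mul, mul_div_assoc', le_div_iff₀ (by positivity)]
    have h₁ : T.card * (e + 1) ≤
        (S.filter fun z => f z ∈ T ∧ Solo G S f z y).card * q := by
      obtain ⟨t, ht⟩ := Nat.exists_eq_add_of_lt hqT
      obtain ⟨p, hp⟩ : ∃ p, q = e + 1 + p := Nat.exists_eq_add_of_le (by omega)
      have : t + 1 + (e + 1) ≤ (S.filter fun z => f z ∈ T ∧ Solo G S f z y).card := by omega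
      calc T.card * (e + 1) ≤ (t + 1 + (e + 1)) * q := by rw [ht, hp]; nlinarith
        _ ≤ _ := Nat.mul_le_mul_right _ this
    exact_mod_cast h₁
  rw [sum_comm] at hlow
  have := hlow.trans hup
  rw [sum_const, sum_const, nsmul_eq_mul, nsmul_eq_mul, hB, hZ] at this
  have h' : (q * s + 1) * T.card ≤ T.card * s * q := by exact_mod_cast this
  nlinarith

/-! ### From nearly equitable to equitable colorings -/

/-- If the solo vertex `z` can be moved within `A`, then moving it, shifting along a path, and
moving its solo neighbor `y` to the old class of `z` makes the coloring equitable on `A`. -/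
lemma hasEquitable_of_movable {A : Finset ι} {P : Set ι} {a X : ι} {y z : V} {s : ℕ} {g : V → ι}
    (hf : ProperOn G S K f) (hAK : A ⊆ K)
    (hs : ∀ c ∈ A, classSize S f c + (if c = a then 1 else 0) = s)
    (hg : ProperOn G ((S.filter fun v => f v ∉ A).erase y) (K \ A) g)
    (hgs : ∀ c ∈ K \ A, classSize ((S.filter fun v => f v ∉ A).erase y) g c = s)
    (hzA : f z ∈ A) (hyS : y ∈ S) (hyA : f y ∉ A) (hsolo : Solo G S f z y)
    (hX : X ∈ A) (hXz : X ≠ f z) (hm : Movable G S f z X)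
    (hP : SimplePath (MoveRel G S f) a X P) (hPA : P ⊆ A) (hzP : f z ∉ P) :
    HasEquitable G S K s := by
  obtain ⟨f₀, h₁, h₂, h₃, h₄, h₅⟩ := exists_shift hf (hPA.trans (coe_subset.2 hAK)) hP
  obtain ⟨hzS, hyz, hsolo⟩ := hsolo
  have hyP : f y ∉ P := fun h => hyA (hPA h)
  have hz₀ : f₀ z = f z := h₂ z hzP
  have hy₀ : f₀ y = f y := h₂ y hyP
  have hA₀ : ∀ v, f₀ v ∈ A ↔ f v ∈ A := fun v => by
    by_cases hv : f v ∈ P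
    · exact iff_of_true (hPA (h₃ v hv)) (hPA hv)
    · rw [h₂ v hv]
  have hzz : ∀ v, f₀ v = f z → f v = f z := fun v hv => by
    by_cases hvP : f v ∈ P
    · exact absurd (hv ▸ h₃ v hvP) hzP
    · rwa [h₂ v hvP] at hv
  have hyne : y ≠ z := hyz.ne
  have p₁ : ProperOn G S K (update f₀ z X) :=
    properOn_update h₁.mem (fun u hu v hv _ _ => h₁.ne u hu v hv) (hAK hX)
      fun w hw hwX => hm w hw (h₄ w hwX)
  have p₂ : ProperOn G S K (update (update f₀ z X) y (f z)) := by
    refine properOn_update p₁.mem (fun u hu v hv _ _ => p₁.ne u hu v hv) (hAK hzA) ?_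
    intro w hw hwz hyw
    by_cases h : w = z
    · subst h
      exact hXz (by simpa using hwz)
    · rw [update_of_ne h] at hwz
      exact h (hsolo w hw (hzz w hwz) hyw)
  set f₁ := update (update f₀ z X) y (f z) with hf₁
  have hB : (S.filter fun v => f₁ v ∉ A) = (S.filter fun v => f v ∉ A).erase y := by
    ext v
    simp only [mem_filter, mem_erase, hf₁]
    by_cases hvy : v = y
    · subst hvy; simp [hzA]
    · by_cases hvz : v = z
      · subst hvz; simp [hvy, hX, hzA]
      · simp [hvy, hvz, hA₀]
  rw [← hB] at hg hgs
  obtain ⟨q₁, q₂, q₃⟩ := properOn_glue hAK (fun u hu v hv h _ => p₂.ne u hu v hv h) hg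
  refine ⟨_, q₁, fun c hc => ?_⟩
  by_cases hcA : c ∈ A
  · rw [q₂ c hcA, hf₁]
    have e₁ := classSize_update (f := update f₀ z X) hyS (f z) c
    have e₂ := classSize_update (f := f₀) hzS X c
    have e₃ := h₅ c
    have e₄ := hs c hcA
    rw [update_of_ne hyne, hy₀, if_neg (fun h => hyA (h ▸ hcA) : c ≠ f y)] at e₁
    rw [hz₀] at e₂
    omega
  · rw [q₃ c (mem_sdiff.2 ⟨hc, hcA⟩), hgs c (mem_sdiff.2 ⟨hc, hcA⟩)]

/-- Moving `z` out of the classes in `A` and its solo neighbor `y` to the old class of `z`. -/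
lemma exists_swap {A : Finset ι} {a Y : ι} {y z : V} {s : ℕ} {g : V → ι}
    (hf : ProperOn G S K f) (hAK : A ⊆ K) (haA : a ∈ A)
    (hs : ∀ c ∈ A, classSize S f c + (if c = a then 1 else 0) = s)
    (hg : ProperOn G ((S.filter fun v => f v ∉ A).erase y) (K \ A) g)
    (hgs : ∀ c ∈ K \ A, classSize ((S.filter fun v => f v ∉ A).erase y) g c = s)
    (hzA : f z ∈ A) (hyS : y ∈ S) (hyA : f y ∉ A) (hsolo : Solo G S f z y)
    (hY : Y ∈ K \ A) (hm : Movable G ((S.filter fun v => f v ∉ A).erase y) g z Y) :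
    ∃ f' : V → ι, ProperOn G S K f' ∧
      (∀ c ∈ K, classSize S f' c + (if c = a then 1 else 0) = s + if c = Y then 1 else 0) ∧
      (∀ v, f v ∈ A → v ≠ z → f' v = f v) ∧ f' y = f z ∧ f' z ∉ A ∧
      ∀ v ∈ S, f v ∉ A → v ≠ y → f' v ∈ K \ A := by
  obtain ⟨hzS, hyz, hsolo⟩ := hsolo
  have hyne : y ≠ z := hyz.ne
  obtain ⟨hYK, hYA⟩ := mem_sdiff.1 hY
  set B := (S.filter fun v => f v ∉ A).erase y with hBdef
  obtain ⟨g₁, g₂⟩ := properOn_insert_update hg (by simp [hBdef, hzA] : z ∉ B) hY hm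
  set f₁ := update (update f z Y) y (f z) with hf₁
  have hy₁ : f₁ y = f z := by simp [hf₁]
  have hz₁ : f₁ z = Y := by simp [hf₁, hyne.symm]
  have hv₁ : ∀ v, v ≠ y → v ≠ z → f₁ v = f v := fun v h h' => by simp [hf₁, h, h']
  have hB : (S.filter fun v => f₁ v ∉ A) = insert z B := by
    ext v
    simp only [mem_filter, mem_insert, hBdef, mem_erase]
    by_cases hvy : v = y
    · subst hvy; simp [hy₁, hzA, hyne]
    · by_cases hvz : v = z
      · subst hvz; simp [hz₁, hYA, hzS]
      · simp [hvy, hvz, hv₁]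
  rw [← hB] at g₁ g₂
  have hp : ∀ u ∈ S, ∀ v ∈ S, G.Adj u v → f₁ u ∈ A → f₁ u ≠ f₁ v := by
    have hsolo' : ∀ w ∈ S, G.Adj y w → f₁ w ≠ f z := by
      intro w hw hyw hwz
      by_cases h : w = z
      · subst h
        exact hYA (by rwa [← hz₁, hwz])
      · rw [hv₁ w hyw.ne' h] at hwz
        exact h (hsolo w hw hwz hyw)
    intro u hu v hv huv huA heq
    by_cases huy : u = y
    · subst huy
      exact hsolo' v hv huv (by rw [← heq, hy₁])
    · by_cases hvy : v = y
      · subst hvy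
        exact hsolo' u hu huv.symm (by rw [heq, hy₁])
      · have huz : u ≠ z := by rintro rfl; exact hYA (hz₁ ▸ huA)
        have hvz : v ≠ z := by rintro rfl; exact hYA (hz₁ ▸ heq ▸ huA)
        rw [hv₁ u huy huz, hv₁ v hvy hvz] at heq
        exact hf.ne u hu v hv huv heq
  obtain ⟨q₁, q₂, q₃⟩ := properOn_glue hAK hp g₁
  refine ⟨_, q₁, fun c hc => ?_, fun v hv hvz => ?_, ?_, ?_, fun v hv hvA hvy => ?_⟩
  · by_cases hcA : c ∈ A
    · rw [q₂ c hcA, hf₁]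
      have e₁ := classSize_update (f := update f z Y) hyS (f z) c
      have e₂ := classSize_update (f := f) hzS Y c
      have e₃ := hs c hcA
      rw [update_of_ne hyne, if_neg (fun h => hyA (h ▸ hcA) : c ≠ f y)] at e₁
      omega
    · have hcKA := mem_sdiff.2 ⟨hc, hcA⟩
      rw [q₃ c hcKA, g₂, hgs c hcKA, if_neg (fun h => hcA (h ▸ haA) : c ≠ a), add_zero]
  · have : f₁ v = f v := hv₁ v (by rintro rfl; exact hyA hv) hvz
    simp only [this, hv, if_true]
  · simp only [hy₁, hzA, if_true]
  · simp [hz₁, hYA]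
  · have hvz : v ≠ z := by rintro rfl; exact hvA hzA
    simp only [hv₁ v hvy hvz, hvA, if_false, update_of_ne hvz]
    exact hg.mem v (by simp [hBdef, hv, hvA, hvy])

/-- A nearly equitable coloring can be made equitable, provided that smaller graphs have equitable
colorings. -/
lemma hasEquitable_of_nearly {s : ℕ} (hdeg : ∀ v ∈ S, (S.filter (G.Adj v)).card < K.card)
    (IH : ∀ T ⊆ S, ∀ L : Finset ι, (∃ y ∈ S, y ∉ T ∧ ∃ w ∈ S, G.Adj y w) →
      T.card = L.card * s → (∀ v ∈ T, (T.filter (G.Adj v)).card < L.card) →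
      HasEquitable G T L s)
    (f : V → ι) (a b : ι) (ha : a ∈ K) (hb : b ∈ K) (hf : ProperOn G S K f)
    (hs : ∀ c ∈ K, classSize S f c + (if c = a then 1 else 0) = s + if c = b then 1 else 0) :
    HasEquitable G S K s := by
  induction hn : (K.filter fun c => ¬ Reaches (MoveRel G S f) K a c).card
    using Nat.strong_induction_on generalizing f b with
  | _ n ih =>
  by_cases hbA : Reaches (MoveRel G S f) K a b
  · obtain ⟨P, hP, hr⟩ := hbA.exists_simplePath
    obtain ⟨f', h₁, -, -, -, h₅⟩ := exists_shift hf (fun e he => (hr e he).mem) hP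
    refine ⟨f', h₁, fun c hc => ?_⟩
    have := h₅ c
    have := hs c hc
    omega
  set A := K.filter fun c => Reaches (MoveRel G S f) K a c with hAdef
  have hmemA : ∀ c, c ∈ A ↔ Reaches (MoveRel G S f) K a c := fun c => by
    simp only [hAdef, mem_filter, and_iff_right_iff_imp]
    exact fun h => by simpa using h.mem
  have hAK : A ⊆ K := filter_subset _ _
  have haA : a ∈ A := (hmemA a).2 (.base ha)
  have hbA' : b ∉ A := fun h => hbA ((hmemA b).1 h)
  have hsA : ∀ c ∈ A, classSize S f c + (if c = a then 1 else 0) = s := fun c hc => by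
    have := hs c (hAK hc)
    rwa [if_neg (fun h => hbA' (h ▸ hc) : c ≠ b), add_zero] at this
  obtain ⟨q, hq⟩ : ∃ q, K.card = A.card + q := Nat.exists_eq_add_of_le (card_le_card hAK)
  have hqKA : (K \ A).card = q := by rw [card_sdiff_of_subset hAK, hq]; omega
  have hB : (S.filter fun v => f v ∉ A).card = q * s + 1 := by
    rw [card_eq_sum_card_fiberwise (s := S.filter fun v => f v ∉ A) (t := K \ A) (f := f)
      fun w hw => mem_coe.2 (mem_sdiff.2 ⟨hf.mem w (mem_filter.1 hw).1, (mem_filter.1 hw).2⟩)]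
    have : ∀ c ∈ K \ A, ((S.filter fun v => f v ∉ A).filter fun v => f v = c).card =
        s + if c = b then 1 else 0 := fun c hc => by
      obtain ⟨hcK, hcA⟩ := mem_sdiff.1 hc
      rw [← hs c hcK, if_neg (fun h => hcA (h ▸ haA) : c ≠ a), add_zero, filter_filter, classSize]
      congr 1
      exact filter_congr fun v _ => ⟨fun h => h.2, fun h => ⟨h ▸ hcA, h⟩⟩
    rw [sum_congr rfl this, sum_add_distrib, sum_ite_eq', if_pos (mem_sdiff.2 ⟨hb, hbA'⟩),
      sum_const, smul_eq_mul, hqKA]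
  have hnotA : ∀ y ∈ S, f y ∉ A → ∀ c ∈ A, ¬ Movable G S f y c := fun y hy hyA c hc hm =>
    hyA ((hmemA _).2 (.step (hf.mem y hy) ⟨fun h => hyA (h ▸ hc), y, hy, rfl, hm⟩
      ((hmemA c).1 hc)))
  rw [hq] at hdeg
  obtain ⟨c₀, hc₀, hc₀a⟩ : ∃ c₀, Reaches (MoveRel G S f) K a c₀ ∧ c₀ ≠ a := by
    by_contra! hcon
    have hAa : A = {a} := by
      ext c
      rw [mem_singleton]
      exact ⟨fun h => hcon c ((hmemA c).1 h), fun h => h ▸ haA⟩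
    have h₁ : (S.filter fun v => f v ∉ A).card * 1 ≤ (S.filter fun v => f v = a).card * q := by
      refine card_mul_le_card_mul G.Adj (fun y hy => ?_) fun x hx => ?_
      · obtain ⟨hyS, hyA⟩ := mem_filter.1 hy
        have := hnotA y hyS hyA a haA
        simp only [Movable, not_forall, not_not] at this
        obtain ⟨w, hw, hwa, hyw⟩ := this
        exact card_pos.2 ⟨w, mem_filter.2 ⟨mem_filter.2 ⟨hw, hwa⟩, hyw⟩⟩
      · have h₁ := hdeg x (mem_filter.1 hx).1
        rw [hAa, card_singleton] at h₁
        refine le_trans (card_le_card fun w hw => ?_) (by omega : (S.filter (G.Adj x)).card ≤ q)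
        obtain ⟨hwB, hwx⟩ := mem_filter.1 hw
        exact mem_filter.2 ⟨(mem_filter.1 hwB).1, hwx.symm⟩
    have h₂ := hsA a haA
    rw [if_pos rfl] at h₂
    change _ ≤ classSize S f a * q at h₁
    rw [hB] at h₁
    nlinarith
  obtain ⟨U, T, hT, hU, hUT, haT, hTA, hterm, hTout⟩ := exists_terminal_set _ K hc₀ hc₀a
  have hTA' : T ⊆ A := fun c hc => (hmemA c).2 (hTA c hc)
  obtain ⟨z, y, hzT, hyS, hyA, hsolo, hcase⟩ := exists_movable_or_nonadj hdeg hTA' hT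
    ((hmemA U).2 hU) hUT (fun c hc => by
      have := hsA c (hTA' hc)
      rwa [if_neg (fun h => haT (h ▸ hc) : c ≠ a), add_zero] at this) hB hnotA
    (fun x hx hxT c hc hcT hcU hm =>
      hTout _ hxT c ((hmemA c).1 hc) hcT hcU ⟨fun h => hcT (h ▸ hxT), x, hx, rfl, hm⟩)
  have hzA := hTA' hzT
  have hzS := hsolo.1
  have hyz := hsolo.2.1
  obtain ⟨g, hg, hgs⟩ : HasEquitable G ((S.filter fun v => f v ∉ A).erase y) (K \ A) s := by
    refine IH _ ((erase_subset _ _).trans (filter_subset _ _)) _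
      ⟨y, hyS, notMem_erase _ _, z, hzS, hyz⟩ ?_ fun v hv => ?_
    · rw [card_erase_of_mem (mem_filter.2 ⟨hyS, hyA⟩), hB, hqKA]
      rfl
    · obtain ⟨-, hvB⟩ := mem_erase.1 hv
      obtain ⟨hvS, hvA⟩ := mem_filter.1 hvB
      have h₁ := hdeg v hvS
      have := card_add_card_le_degree (C := A) (S := S)
        (X := ((S.filter fun v => f v ∉ A).erase y).filter (G.Adj v)) (hnotA v hvS hvA)
        (fun w hw => mem_filter.2
          ⟨(mem_filter.1 (mem_of_mem_erase (mem_filter.1 hw).1)).1, (mem_filter.1 hw).2⟩)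
        (fun w hw => (mem_filter.1 (mem_of_mem_erase (mem_filter.1 hw).1)).2)
      omega
  by_cases hmov : ∃ X ∈ A, X ≠ f z ∧ Movable G S f z X
  · obtain ⟨X, hX, hXz, hm⟩ := hmov
    obtain ⟨P, hP, hr⟩ := (hterm _ hzT X ((hmemA X).1 hX) hXz).exists_simplePath
    exact hasEquitable_of_movable hf hAK hsA hg hgs hzA hyS hyA hsolo hX hXz hm hP
      (fun e he => (hmemA e).2 ((hr e he).mono fun e' he' => he'.mem.1))
      (fun h => (hr _ h).mem.2 rfl)
  · obtain ⟨y', hy'S, hy'A, hsolo', hy'y, hnadj⟩ := hcase.resolve_left hmov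
    push Not at hmov
    obtain ⟨Y, hY, hmY⟩ : ∃ Y ∈ K \ A,
        Movable G ((S.filter fun v => f v ∉ A).erase y) g z Y := by
      apply exists_movable_color
      have h₁ := hdeg z hzS
      have := card_add_card_le_degree (C := A.erase (f z)) (S := S)
        (X := (S.filter fun v => f v ∉ A).filter (G.Adj z))
        (fun c hc => hmov c (mem_of_mem_erase hc) (ne_of_mem_erase hc))
        (filter_subset_filter _ (filter_subset _ _))
        (fun w hw h => (mem_filter.1 (mem_filter.1 hw).1).2 (mem_of_mem_erase h))
      rw [card_erase_of_mem hzA] at this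
      rw [filter_erase, card_erase_of_mem
        (mem_filter.2 ⟨mem_filter.2 ⟨hyS, hyA⟩, hyz.symm⟩), hqKA]
      have h₂ := card_pos.2 ⟨_, hzA⟩
      have h₃ : 0 < ((S.filter fun v => f v ∉ A).filter (G.Adj z)).card :=
        card_pos.2 ⟨y, mem_filter.2 ⟨mem_filter.2 ⟨hyS, hyA⟩, hyz.symm⟩⟩
      omega
    obtain ⟨f', hf', hs', hk, hy₁, hz₁, hk'⟩ :=
      exists_swap hf hAK haA hsA hg hgs hzA hyS hyA hsolo hY hmY
    have hcol : ∀ v ∈ S, f' v ∈ A → v ≠ y → f v = f' v ∧ v ≠ z := by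
      intro v hv hvA hvy
      have hvz : v ≠ z := by rintro rfl; exact hz₁ hvA
      by_cases h : f v ∈ A
      · exact ⟨(hk v h hvz).symm, hvz⟩
      · exact absurd hvA (mem_sdiff.1 (hk' v hv h hvy)).2
    have hrel : ∀ c ∈ A, ∀ d ∈ A, d ≠ f z → MoveRel G S f c d → MoveRel G S f' c d := by
      rintro c hc d hd hdz ⟨hcd, x, hx, rfl, hm⟩
      have hxz : x ≠ z := by rintro rfl; exact hmov d hd hdz hm
      refine ⟨hcd, x, hx, hk x hc hxz, fun w hw hwd => hm w hw ?_⟩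
      have hwy : w ≠ y := by rintro rfl; exact hdz (hwd ▸ hy₁)
      rw [(hcol w hw (hwd ▸ hd) hwy).1, hwd]
    have hr₁ : ∀ c, Reaches (MoveRel G S f) (K \ {f z} : Set ι) a c →
        Reaches (MoveRel G S f') K a c := by
      intro c hc
      induction hc with
      | base h => exact .base h.1
      | @step c d h₁ h₂ h₃ ih =>
        have hd : d ∈ A := (hmemA d).2 (h₃.mono fun e he => he.mem.1)
        exact .step h₁.1 (hrel c ((hmemA c).2 (.step h₁.1 h₂ ((hmemA d).1 hd))) d hd h₃.mem.2 h₂) ih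
    have hr₂ : Reaches (MoveRel G S f') K a (f z) := by
      cases (hmemA _).1 hzA with
      | base h => exact absurd hzT haT
      | @step _ d h₁ h₂ h₃ =>
        exact .step h₁ (hrel _ hzA d ((hmemA d).2 h₃) h₂.1.symm h₂)
          (hr₁ d (hterm _ hzT d h₃ h₂.1.symm))
    have hr₃ : ∀ c ∈ A, Reaches (MoveRel G S f') K a c := fun c hc => by
      by_cases h : c = f z
      · rwa [h]
      · exact hr₁ c (hterm _ hzT c ((hmemA c).1 hc) h)
    have hy'KA := hk' y' hy'S hy'A hy'y
    have hr₄ : Reaches (MoveRel G S f') K a (f' y') := by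
      obtain ⟨h₁, h₂⟩ := mem_sdiff.1 hy'KA
      refine .step h₁ ⟨fun h => h₂ (h ▸ hzA), y', hy'S, rfl, fun w hw hwz hadj => ?_⟩ hr₂
      by_cases hwy : w = y
      · exact hnadj (hwy ▸ hadj).symm
      · obtain ⟨h₃, h₄⟩ := hcol w hw (hwz ▸ hzA) hwy
        exact h₄ (hsolo'.2.2 w hw (h₃.trans hwz) hadj)
    refine ih _ ?_ f' Y (mem_sdiff.1 hY).1 hf' hs' rfl
    rw [← hn]
    refine card_lt_card ⟨fun c hc => ?_, fun h => ?_⟩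
    · obtain ⟨hcK, hc⟩ := mem_filter.1 hc
      exact mem_filter.2 ⟨hcK, fun h => hc (hr₃ c ((hmemA c).2 h))⟩
    · obtain ⟨h₁, h₂⟩ := mem_sdiff.1 hy'KA
      exact (mem_filter.1 (h (mem_filter.2 ⟨h₁, fun h => h₂ ((hmemA _).2 h)⟩))).2 hr₄

/-! ### The theorem -/

lemma exists_coloring_classSize [Nonempty ι] (S : Finset V) (K : Finset ι) (s : ℕ)
    (hS : S.card = K.card * s) :
    ∃ f : V → ι, (∀ v ∈ S, f v ∈ K) ∧ ∀ c ∈ K, classSize S f c = s := by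
  induction K using Finset.induction generalizing S with
  | empty =>
    obtain rfl : S = ∅ := by simpa using hS
    exact ⟨fun _ => Classical.arbitrary ι, by simp, by simp⟩
  | insert c K hc ih =>
    rw [card_insert_of_notMem hc, Nat.succ_mul] at hS
    obtain ⟨T, hTS, hT⟩ := exists_subset_card_eq (hS ▸ Nat.le_add_left _ _ : s ≤ S.card)
    obtain ⟨f, hf, hfs⟩ := ih (S \ T) (by rw [card_sdiff_of_subset hTS]; omega)
    refine ⟨fun v => if v ∈ T then c else f v, fun v hv => ?_, fun d hd => ?_⟩
    · dsimp only
      split_ifs with h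
      · exact mem_insert_self _ _
      · exact mem_insert_of_mem (hf v (mem_sdiff.2 ⟨hv, h⟩))
    · rcases mem_insert.1 hd with rfl | hdK
      · rw [← hT, classSize]
        congr 1
        ext v
        by_cases h : v ∈ T
        · simp [h, hTS h]
        · simp only [mem_filter, h, if_false, iff_false, not_and]
          rintro hv rfl
          exact hc (hf v (mem_sdiff.2 ⟨hv, h⟩))
      · rw [← hfs d hdK, classSize, classSize]
        congr 1
        ext v
        by_cases h : v ∈ T
        · simp only [mem_filter, h, if_true, mem_sdiff, not_true_eq_false, and_false, false_and,
            iff_false, not_and]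
          rintro - rfl
          exact hc hdK
        · simp [h]

/-- The Hajnal–Szemerédi theorem for `G[S]` when the number of colors divides `|S|`. -/
theorem hasEquitable_of_degree_lt [Nonempty ι] (G : SimpleGraph V) (S : Finset V) (K : Finset ι)
    (s : ℕ) (hS : S.card = K.card * s)
    (hdeg : ∀ v ∈ S, (S.filter (G.Adj v)).card < K.card) : HasEquitable G S K s := by
  induction hn : ((S ×ˢ S).filter fun p => G.Adj p.1 p.2).card
    using Nat.strong_induction_on generalizing G S K with
  | _ n ih =>
  subst hn
  by_cases hE : ∃ u ∈ S, ∃ w ∈ S, G.Adj u w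
  swap
  · push Not at hE
    obtain ⟨f, hf, hfs⟩ := exists_coloring_classSize S K s hS
    exact ⟨f, ⟨hf, fun u hu v hv h => absurd h (hE u hu v hv)⟩, hfs⟩
  obtain ⟨u, hu, w, hw, huw⟩ := hE
  obtain ⟨f, hf, hfs⟩ : HasEquitable (G.deleteIncidenceSet u) S K s := by
    refine ih _ (card_lt_card ⟨fun p hp => ?_, fun h => ?_⟩) _ S K hS (fun v hv => ?_) rfl
    · simp only [mem_filter, SimpleGraph.deleteIncidenceSet_adj] at hp ⊢
      exact ⟨hp.1, hp.2.1⟩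
    · have := h (mem_filter.2 ⟨mem_product.2 ⟨hu, hw⟩, huw⟩ : (u, w) ∈ _)
      simp [SimpleGraph.deleteIncidenceSet_adj] at this
    · refine lt_of_le_of_lt (card_le_card fun x hx => ?_) (hdeg v hv)
      simp only [mem_filter, SimpleGraph.deleteIncidenceSet_adj] at hx ⊢
      exact ⟨hx.1, hx.2.1⟩
  obtain ⟨d, hd, hm⟩ := exists_movable_color (f := f) (hdeg u hu)
  refine hasEquitable_of_nearly hdeg (fun T hT L hy hTL hTdeg => ?_) (update f u d) (f u) d
    (hf.mem u hu) hd (properOn_update hf.mem (fun x hx v hv hxu hvu hxv => ?_) hd hm)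
    fun c hc => ?_
  · obtain ⟨y, hyS, hyT, x, hx, hyx⟩ := hy
    refine ih _ (card_lt_card ⟨?_, fun h => ?_⟩) G T L hTL hTdeg rfl
    · exact filter_subset_filter _ (product_subset_product hT hT)
    · have := h (mem_filter.2 ⟨mem_product.2 ⟨hyS, hx⟩, hyx⟩ : (y, x) ∈ _)
      exact hyT (mem_product.1 (mem_filter.1 this).1).1
  · exact hf.ne x hx v hv (SimpleGraph.deleteIncidenceSet_adj.2 ⟨hxv, hxu, hvu⟩)
  · rw [classSize_update hu, hfs c hc]

end HajnalSzemeredi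

/-- Hajnal–Szemerédi theorem: a finite simple graph on `n` vertices with maximum degree
at most `Δ` has a proper coloring with `Δ + 1` colors in which every color class has
size `⌊n/(Δ+1)⌋` or `⌈n/(Δ+1)⌉`. -/
theorem hajnal_szemeredi {V : Type*} [Fintype V] [DecidableEq V]
    (G : SimpleGraph V) [DecidableRel G.Adj] (Δ : ℕ)
    (hΔ : ∀ v : V, G.degree v ≤ Δ) :
    ∃ C : V → Fin (Δ + 1),
      (∀ u v : V, G.Adj u v → C u ≠ C v) ∧
      (∀ c : Fin (Δ + 1),
        (Finset.univ.filter (fun v => C v = c)).card = Fintype.card V / (Δ + 1) ∨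
        (Finset.univ.filter (fun v => C v = c)).card = (Fintype.card V + Δ) / (Δ + 1)) := by
  classical
  set n := Fintype.card V with hn
  set s := (n + Δ) / (Δ + 1) with hs
  -- Pad with a complete graph on `p` vertices.
  obtain ⟨p, hp, hnp⟩ : ∃ p ≤ Δ, n + p = (Δ + 1) * s := by
    have h₁ := Nat.div_add_mod (n + Δ) (Δ + 1)
    rw [← hs] at h₁
    have h₂ : (n + Δ) % (Δ + 1) < Δ + 1 := Nat.mod_lt _ (Nat.succ_pos Δ)
    exact ⟨Δ - (n + Δ) % (Δ + 1), by omega, by omega⟩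
  have hE := HajnalSzemeredi.hasEquitable_of_degree_lt (ι := Fin (Δ + 1))
    (G ⊕g (⊤ : SimpleGraph (Fin p))) Finset.univ Finset.univ s (by simpa [← hn] using hnp) ?_
  · obtain ⟨f, hf, hfs⟩ := hE
    refine ⟨fun v => f (.inl v), fun u v huv => hf.ne _ (Finset.mem_univ _) _ (Finset.mem_univ _)
      (by simpa using huv), fun c => ?_⟩
    change (Finset.univ.filter fun v => f (.inl v) = c).card = _ ∨
      (Finset.univ.filter fun v => f (.inl v) = c).card = _
    have h₁ : HajnalSzemeredi.classSize Finset.univ f c =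
        (Finset.univ.filter fun v => f (.inl v) = c).card +
          (Finset.univ.filter fun i => f (.inr i) = c).card := by
      rw [HajnalSzemeredi.classSize, ← Finset.card_disjSum]
      congr 1
      ext (v | i) <;> simp
    have h₂ : (Finset.univ.filter fun i => f (.inr i) = c).card ≤ 1 := by
      refine Finset.card_le_one.2 fun i hi j hj => ?_
      by_contra hij
      simp only [Finset.mem_filter, Finset.mem_univ, true_and] at hi hj
      exact hf.ne (.inr i) (Finset.mem_univ _) (.inr j) (Finset.mem_univ _) (by simpa using hij)
        (hi.trans hj.symm)
    have h₃ : (Finset.univ.filter fun i => f (.inr i) = c).card ≤ p :=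
      (Finset.card_filter_le _ _).trans (by simp)
    rw [hfs c (Finset.mem_univ _)] at h₁
    rcases Nat.eq_zero_or_pos (Finset.univ.filter fun i => f (.inr i) = c).card with h₄ | h₄
    · right; omega
    · left
      obtain ⟨s', hs'⟩ : ∃ s', s = s' + 1 := ⟨s - 1, by omega⟩
      have : n / (Δ + 1) = s' := by
        rw [hs'] at hnp
        exact Nat.div_eq_of_lt_le (by nlinarith) (by nlinarith)
      omega
  · rintro (v | i) -
    · have : (Finset.univ.filter ((G ⊕g (⊤ : SimpleGraph (Fin p))).Adj (.inl v))) =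
          (G.neighborFinset v).map .inl := by
        ext (w | w) <;> simp
      rw [this, Finset.card_map, Finset.card_fin]
      exact Nat.lt_succ_of_le (hΔ v)
    · have : (Finset.univ.filter ((G ⊕g (⊤ : SimpleGraph (Fin p))).Adj (.inr i))) ⊆
          Finset.univ.map .inr := by
        rintro (w | w) <;> simp
      have := Finset.card_le_card this
      rw [Finset.card_map, Finset.card_fin] at this
      rw [Finset.card_fin]
      omega
end

section
/- Let G be a finite simple graph on N ≥ 1 vertices with maximum degree Δ and average degree D = 2·e(G)/N, and let x be a real number with 0 < x < D. Then the number of vertices w of G with d(w) ≥ D − x is at least x·N/(Δ − D + x). -/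
/-- The counting core of Claim 4.1: in a graph on `N ≥ 1` vertices with maximum degree `Δ`
and average degree `D = 2·e(G)/N`, for any real `0 < x < D` the number of vertices `w`
with `d(w) ≥ D - x` is at least `x·N/(Δ - D + x)`. -/
theorem many_vertices_of_large_degree {V : Type*} [Fintype V] [DecidableEq V]
    (G : SimpleGraph V) [DecidableRel G.Adj]
    (hN : 1 ≤ Fintype.card V) (D x : ℝ)
    (hD : D = 2 * (G.edgeFinset.card : ℝ) / (Fintype.card V : ℝ))
    (hx0 : 0 < x) (hxD : x < D) :
    x * (Fintype.card V : ℝ) / ((G.maxDegree : ℝ) - D + x)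
      ≤ ((Finset.univ.filter (fun w : V => D - x ≤ (G.degree w : ℝ))).card : ℝ) := by
  have hN' : (0 : ℝ) < Fintype.card V := by exact_mod_cast hN
  have hsum : ∑ w, (G.degree w : ℝ) = D * Fintype.card V := by
    rw [hD, div_mul_cancel₀ _ hN'.ne']
    exact_mod_cast G.sum_degrees_eq_twice_card_edges
  have hdeg (w : V) : (G.degree w : ℝ) ≤ G.maxDegree := by
    exact_mod_cast G.degree_le_maxDegree w
  have hDΔ : D ≤ G.maxDegree := by
    refine le_of_mul_le_mul_right ?_ hN'
    rw [← hsum]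
    calc ∑ w, (G.degree w : ℝ) ≤ ∑ _w : V, (G.maxDegree : ℝ) :=
          Finset.sum_le_sum fun w _ => hdeg w
      _ = G.maxDegree * Fintype.card V := by
          simp [mul_comm]
  rw [div_le_iff₀ (by linarith)]
  calc x * (Fintype.card V : ℝ) = ∑ w, ((G.degree w : ℝ) - (D - x)) := by
        rw [Finset.sum_sub_distrib, hsum, Finset.sum_const, Finset.card_univ, nsmul_eq_mul]
        ring
    _ ≤ ∑ w, if D - x ≤ (G.degree w : ℝ) then (G.maxDegree : ℝ) - D + x else 0 := by
        refine Finset.sum_le_sum fun w _ => ?_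
        split_ifs with h
        · linarith [hdeg w]
        · linarith
    _ = _ := by
        rw [← Finset.sum_filter, Finset.sum_const, nsmul_eq_mul]
end

section
/- For every real number b ≥ 2 and every real number t with 0 ≤ t ≤ 23·b·ln b, setting y := 60·b·ln b, the inequality 4b + 1 + 2b·ln(y/(y − 2t)) < (y − 2t) − 1 − 2b/(y − 2t) holds. -/
/-- The quantitative content of Stage 2 of Theorem 1.2: for every real `b ≥ 2` and every
real `0 ≤ t ≤ 23·b·ln b`, with `y = 60·b·ln b`,
`4b + 1 + 2b·ln(y/(y − 2t)) < (y − 2t) − 1 − 2b/(y − 2t)`. -/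
theorem stage2_duration_inequality (b t : ℝ) (hb : 2 ≤ b) (ht0 : 0 ≤ t)
    (ht : t ≤ 23 * b * Real.log b) :
    4 * b + 1 + 2 * b * Real.log ((60 * b * Real.log b) / (60 * b * Real.log b - 2 * t))
      < (60 * b * Real.log b - 2 * t) - 1 - 2 * b / (60 * b * Real.log b - 2 * t) := by
  have hL : 0.69 < Real.log b := by
    have := Real.log_le_log (by norm_num) hb
    linarith [Real.log_two_gt_d9]
  set L := Real.log b
  have hbL : 0.69 * b < b * L := by nlinarith
  set w := 60 * b * L - 2 * t with hw
  have hw14 : 14 * (b * L) ≤ w := by linarith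
  have hwb : 9.66 * b < w := by linarith
  have hw0 : 0 < w := by linarith
  have hlog : Real.log (60 * b * L / w) ≤ 3 / 2 := by
    have hratio : 60 * b * L / w ≤ 2 ^ 2 * (15 / 14) := by
      rw [div_le_iff₀ hw0]
      linarith
    have hpos : 0 < 60 * b * L / w := by
      apply div_pos _ hw0
      linarith
    have h₁ := Real.log_le_log hpos hratio
    rw [Real.log_mul (by norm_num) (by norm_num), Real.log_pow] at h₁
    have h₂ := Real.log_le_sub_one_of_pos (show (0 : ℝ) < 15 / 14 by norm_num)
    push_cast at h₁
    linarith [Real.log_two_lt_d9]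
  have hdiv : 2 * b / w ≤ 1 := by
    rw [div_le_one hw0]
    linarith
  have hmul : 2 * b * Real.log (60 * b * L / w) ≤ 2 * b * (3 / 2) := by gcongr
  linarith
end
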